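/- Let (S,d) be a geodesic metric space homeomorphic to the 2-sphere, let γ : S¹ → S be a continuous map whose range is not all of S, let U be a connected component of S \ range(γ), and set A = S \ U. Then for every ε > 0, γ is null-homotopic inside the open ε-neighborhood of A: there exists a continuous map H : [0,1] × S¹ → S and a point c ∈ S such that H(0,z) = γ(z) and H(1,z) = c for all z ∈ S¹, and H(t,z) lies in the ε-thickening {w ∈ S : dist(w, A) < ε} of A for all (t,z). -/

import Mathlib

/-- A metric space is geodesic if any two points are joined by an isometric path. -/
def IsGeodesicSpace (S : Type*) [MetricSpace S] : Prop :=
  ∀ x y : S, ∃ γ : ℝ → S, γ 0 = x ∧ γ (dist x y) = y ∧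
    ∀ s ∈ Set.Icc (0 : ℝ) (dist x y), ∀ t ∈ Set.Icc (0 : ℝ) (dist x y),
      dist (γ s) (γ t) = |s - t|

section SphereLoop

open Set Metric

theorem Complex.mem_segment_iff_div_sub_notMem_slitPlane {p q z : ℂ} (hz : z ≠ q) :
    z ∈ segment ℝ p q ↔ (z - p) / (z - q) ∉ Complex.slitPlane := by
  have hzq : z - q ≠ 0 := sub_ne_zero.2 hz
  constructor
  · rintro ⟨a, b, ha, hb, hab, rfl⟩
    have hpq : p - q ≠ 0 := by
      rintro h
      obtain rfl := sub_eq_zero.1 h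
      exact hz (by rw [← add_smul, hab, one_smul])
    have ha0 : a ≠ 0 := by
      rintro rfl
      simp only [zero_add] at hab
      simp [hab] at hz
    have key : (a • p + b • q - p) / (a • p + b • q - q) = ((-b / a : ℝ) : ℂ) := by
      obtain rfl : b = 1 - a := by linarith
      rw [div_eq_iff hzq]
      have : (a : ℂ) ≠ 0 := by exact_mod_cast ha0
      simp only [Complex.real_smul]
      push_cast
      field_simp
      ring
    rw [key, Complex.ofReal_mem_slitPlane, not_lt]
    exact div_nonpos_of_nonpos_of_nonneg (by linarith) ha
  · intro h
    simp only [Complex.mem_slitPlane_iff, not_or, not_lt, not_not] at h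
    obtain ⟨s, hs, hsz⟩ : ∃ s : ℝ, 0 ≤ s ∧ (z - p) / (z - q) = ((-s : ℝ) : ℂ) :=
      ⟨-((z - p) / (z - q)).re, by linarith [h.1], Complex.ext (by simp) (by simp [h.2])⟩
    rw [div_eq_iff hzq] at hsz
    have hs1 : (1 + s : ℂ) ≠ 0 := by exact_mod_cast (by linarith : (1 + s : ℝ) ≠ 0)
    refine ⟨1 / (1 + s), s / (1 + s), by positivity, by positivity, by field_simp, ?_⟩
    simp only [Complex.real_smul]
    push_cast at hsz ⊢
    field_simp
    linear_combination -hsz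

/-- If `F` omits the endpoints of a segment, and sends a compact connected set `B` off the whole
segment, then `F` can be changed away from `B`, with new values in the open disc having the segment
as a diameter, so as to omit the segment. -/
theorem exists_continuous_eqOn_notMem_segment {X : Type*} [TopologicalSpace X]
    [SimplyConnectedSpace X] [LocallyPathConnectedSpace X] {B : Set X} (hBc : IsCompact B)
    (hB : IsConnected B) {p q : ℂ} (hpq : p ≠ q) {F : X → ℂ} (hF : Continuous F)
    (hp : ∀ x, F x ≠ p) (hq : ∀ x, F x ≠ q) (hFB : ∀ x ∈ B, F x ∉ segment ℝ p q) :
    ∃ G : X → ℂ, Continuous G ∧ EqOn G F B ∧ (∀ x, G x ∉ segment ℝ p q) ∧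
      ∀ x, G x = F x ∨ ((G x - p) / (G x - q)).re < 0 := by
  have hp' : ∀ x, F x - p ≠ 0 := fun x ↦ sub_ne_zero.2 (hp x)
  have hq' : ∀ x, F x - q ≠ 0 := fun x ↦ sub_ne_zero.2 (hq x)
  set ζ : X → ℂ := fun x ↦ (F x - p) / (F x - q) with hζ
  have hζc : Continuous ζ := by fun_prop (disch := assumption)
  have hζ0 : ∀ x, ζ x ≠ 0 := fun x ↦ div_ne_zero (hp' x) (hq' x)
  have hζ1 : ∀ x, ζ x ≠ 1 := fun x h ↦ hpq (by
    have := (div_eq_one_iff_eq (hq' x)).1 h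
    linear_combination -this)
  have hζB : ∀ x ∈ B, ζ x ∈ Complex.slitPlane := fun x hx ↦ by
    simpa [Complex.mem_segment_iff_div_sub_notMem_slitPlane (hq x)] using hFB x hx
  obtain ⟨b, hb⟩ := hB.nonempty
  obtain ⟨g, ⟨hgb, hg⟩, -⟩ := Complex.isCoveringMapOn_exp.existsUnique_continuousMap_lifts
    ⟨ζ, hζc⟩ (a₀ := b) (Complex.exp_log (hζ0 b)) hζ0
  replace hg : ∀ x, Complex.exp (g x) = ζ x := fun x ↦ congrFun hg x
  have hgB : ∀ x ∈ B, g x = Complex.log (ζ x) := by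
    have hlog : ContinuousOn (fun x ↦ Complex.log (ζ x)) B := hζc.continuousOn.clog hζB
    refine Complex.isCoveringMap_exp.eqOn_of_comp_eqOn hB.isPreconnected
      (map_continuous g).continuousOn hlog (fun x _ ↦ ?_) hb hgb
    simp [hg, Complex.exp_log (hζ0 x)]
  obtain ⟨θ, hθ₁, hθ₂, hθB⟩ : ∃ θ, Real.pi / 2 < θ ∧ θ < Real.pi ∧ ∀ x ∈ B, |(g x).im| ≤ θ := by
    obtain ⟨x, hx, hmax⟩ := hBc.exists_isMaxOn ⟨b, hb⟩
      (f := fun x ↦ |(g x).im|) (by fun_prop)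
    have hlt : |(g x).im| < Real.pi := by
      rw [hgB x hx, Complex.log_im, abs_lt]
      have := Complex.mem_slitPlane_iff_arg.1 (hζB x hx)
      exact ⟨Complex.neg_pi_lt_arg _, lt_of_le_of_ne (Complex.arg_le_pi _) this.1⟩
    obtain ⟨θ, h₁, h₂⟩ := exists_between
      (max_lt hlt (by linarith [Real.pi_pos] : Real.pi / 2 < Real.pi))
    exact ⟨θ, (le_max_right _ _).trans_lt h₁, h₂,
      fun y hy ↦ (hmax hy).trans ((le_max_left _ _).trans h₁.le)⟩
  set k : X → ℂ := fun x ↦ Complex.mk (g x).re (max (-θ) (min θ (g x).im)) with hk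
  have hkc : Continuous k := by
    have : k = fun x ↦ (((g x).re : ℝ) : ℂ) + ((max (-θ) (min θ (g x).im) : ℝ) : ℂ) * Complex.I := by
      funext x
      exact Complex.mk_eq_add_mul_I _ _
    rw [this]
    fun_prop
  have hkg : ∀ x, |(g x).im| ≤ θ → k x = g x := fun x hx ↦ by
    rw [abs_le] at hx
    apply Complex.ext <;> simp [hk, hx.1, hx.2]
  have hkim : ∀ x, |(k x).im| ≤ θ := fun x ↦ by
    rw [abs_le]
    exact ⟨le_max_left _ _, max_le (by linarith) (min_le_left _ _)⟩
  have hkeq : ∀ x, ¬ |(g x).im| ≤ θ → |(k x).im| = θ := fun x hx ↦ by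
    have hθ : 0 < θ := by linarith [Real.pi_pos]
    rw [not_le, lt_abs] at hx
    rcases hx with hx | hx
    · simp [hk, hx.le, abs_of_pos hθ, (by linarith : -θ ≤ θ)]
    · have : (k x).im = -θ := by
        simp only [hk]
        rw [min_eq_right (by linarith), max_eq_left (by linarith)]
      rw [this, abs_neg, abs_of_pos hθ]
  have hk1 : ∀ x, Complex.exp (k x) ≠ 1 := fun x h ↦ by
    have hk0 : k x = 0 := by
      rw [← Complex.log_exp (x := k x) (by linarith [(abs_le.1 (hkim x)).1])
        (by linarith [(abs_le.1 (hkim x)).2]), h, Complex.log_one]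
    have hgx : |(g x).im| ≤ θ := by
      by_contra hx
      have := hkeq x hx
      rw [hk0, Complex.zero_im, abs_zero] at this
      linarith [Real.pi_pos]
    exact hζ1 x (by rw [← hg, ← hkg x hgx, h])
  have hk1' : ∀ x, Complex.exp (k x) - 1 ≠ 0 := fun x ↦ sub_ne_zero.2 (hk1 x)
  set G : X → ℂ := fun x ↦ (q * Complex.exp (k x) - p) / (Complex.exp (k x) - 1) with hG
  have hGF : ∀ x, |(g x).im| ≤ θ → G x = F x := fun x hx ↦ by
    have h1 := hk1' x
    simp only [hG]
    rw [div_eq_iff h1, hkg x hx, hg]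
    have := hq' x
    simp only [hζ]
    field_simp
    ring
  have hGq : ∀ x, G x ≠ q := fun x h ↦ by
    rw [hG, div_eq_iff (hk1' x)] at h
    exact hpq (by linear_combination -h)
  have hGζ : ∀ x, (G x - p) / (G x - q) = Complex.exp (k x) := fun x ↦ by
    have := hk1' x
    rw [div_eq_iff (sub_ne_zero.2 (hGq x))]
    simp only [hG]
    field_simp
    ring
  refine ⟨G, by fun_prop (disch := assumption), fun x hx ↦ hGF x (hθB x hx), fun x ↦ ?_,
    fun x ↦ ?_⟩
  · rw [Complex.mem_segment_iff_div_sub_notMem_slitPlane (hGq x), hGζ, not_not, Complex.mem_slitPlane_iff_arg]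
    refine ⟨?_, Complex.exp_ne_zero _⟩
    rw [← Complex.log_im, Complex.log_exp (by linarith [(abs_le.1 (hkim x)).1])
        (by linarith [(abs_le.1 (hkim x)).2])]
    linarith [(abs_le.1 (hkim x)).2]
  · refine or_iff_not_imp_left.2 fun h ↦ ?_
    have := hkeq x fun h' ↦ h (hGF x h')
    rw [hGζ, Complex.exp_re]
    refine mul_neg_of_pos_of_neg (Real.exp_pos _) ?_
    rw [← Real.cos_abs, this]
    exact Real.cos_neg_of_pi_div_two_lt_of_lt hθ₁ (by linarith)

/-- A finite family of segments, none of which meets the open disc having another one as a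
diameter, can be omitted as soon as all the endpoints are. -/
theorem exists_continuous_eqOn_notMem_segments {X : Type*} [TopologicalSpace X]
    [SimplyConnectedSpace X] [LocallyPathConnectedSpace X] {B : Set X} (hBc : IsCompact B)
    (hB : IsConnected B) (s : Finset (ℂ × ℂ)) (hne : ∀ e ∈ s, e.1 ≠ e.2)
    (hs : ∀ e ∈ s, ∀ e' ∈ s, e ≠ e' → ∀ z ∈ segment ℝ e'.1 e'.2, 0 ≤ ((z - e.1) / (z - e.2)).re)
    {F : X → ℂ} (hF : Continuous F) (hFs : ∀ e ∈ s, ∀ x, F x ≠ e.1 ∧ F x ≠ e.2)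
    (hFB : ∀ x ∈ B, ∀ e ∈ s, F x ∉ segment ℝ e.1 e.2) :
    ∃ G : X → ℂ, Continuous G ∧ EqOn G F B ∧ ∀ e ∈ s, ∀ x, G x ∉ segment ℝ e.1 e.2 := by
  suffices H : ∀ t ⊆ s, ∃ G : X → ℂ, Continuous G ∧ EqOn G F B ∧
      (∀ e ∈ s, ∀ x, G x ≠ e.1 ∧ G x ≠ e.2) ∧ ∀ e ∈ t, ∀ x, G x ∉ segment ℝ e.1 e.2 by
    obtain ⟨G, h₁, h₂, -, h₃⟩ := H s subset_rfl
    exact ⟨G, h₁, h₂, h₃⟩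
  intro t
  induction t using Finset.induction_on with
  | empty => exact fun _ ↦ ⟨F, hF, eqOn_refl F B, hFs, by simp⟩
  | insert e t het ih =>
    intro hst
    rw [Finset.insert_subset_iff] at hst
    obtain ⟨G, hG, hGF, hGs, hGt⟩ := ih hst.2
    obtain ⟨G', hG', hGG', hGe, hdisc⟩ := exists_continuous_eqOn_notMem_segment hBc hB
      (hne e hst.1) hG (fun x ↦ (hGs e hst.1 x).1) (fun x ↦ (hGs e hst.1 x).2)
      (fun x hx ↦ by rw [hGF hx]; exact hFB x hx e hst.1)
    have key : ∀ e' ∈ s, e ≠ e' → ∀ x, G x ∉ segment ℝ e'.1 e'.2 →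
        G' x ∉ segment ℝ e'.1 e'.2 := fun e' he' hee' x hx hx' ↦ by
      rcases hdisc x with h | h
      · exact hx (h ▸ hx')
      · exact h.not_ge (hs e hst.1 e' he' hee' _ hx')
    refine ⟨G', hG', hGG'.trans hGF, fun e' he' x ↦ ?_, fun e' he' x ↦ ?_⟩
    · by_cases hee' : e = e'
      · subst hee'
        exact ⟨fun h ↦ hGe x (h ▸ left_mem_segment ℝ _ _),
          fun h ↦ hGe x (h ▸ right_mem_segment ℝ _ _)⟩
      · have aux : ∀ z ∈ segment ℝ e'.1 e'.2, G x ≠ z → G' x ≠ z := fun z hz hx hx' ↦ by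
          rcases hdisc x with h | h
          · exact hx (h ▸ hx')
          · exact h.not_ge (hx' ▸ hs e hst.1 e' he' hee' _ hz)
        exact ⟨aux _ (left_mem_segment ℝ _ _) (hGs e' he' x).1,
          aux _ (right_mem_segment ℝ _ _) (hGs e' he' x).2⟩
    · by_cases hee' : e = e'
      · exact hee' ▸ hGe x
      · exact key e' (by aesop) hee' x (hGt e' (by aesop) x)

/-- The edges of the square grid of mesh `δ`: the one starting at `δ (m + n i)` and pointing
upwards if `b`, and to the right otherwise. -/
def gridEdge (δ : ℝ) (i : ℤ × ℤ × Bool) : ℂ × ℂ :=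
  (⟨δ * i.1, δ * i.2.1⟩,
    if i.2.2 then ⟨δ * i.1, δ * (i.2.1 + 1)⟩ else ⟨δ * (i.1 + 1), δ * i.2.1⟩)

theorem mem_segment_gridEdge_true {δ : ℝ} (hδ : 0 < δ) {m n : ℤ} {z : ℂ} :
    z ∈ segment ℝ (gridEdge δ (m, n, true)).1 (gridEdge δ (m, n, true)).2 ↔
      z.re = δ * m ∧ δ * n ≤ z.im ∧ z.im ≤ δ * (n + 1) := by
  simp only [gridEdge, if_true]
  constructor
  · rintro ⟨a, b, ha, hb, hab, rfl⟩
    obtain rfl : a = 1 - b := by linarith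
    simp only [Complex.add_re, Complex.smul_re, Complex.add_im, Complex.smul_im, smul_eq_mul]
    exact ⟨by ring, by nlinarith, by nlinarith⟩
  · rintro ⟨h₁, h₂, h₃⟩
    refine ⟨(δ * (n + 1) - z.im) / δ, (z.im - δ * n) / δ, div_nonneg (by linarith) hδ.le,
      div_nonneg (by linarith) hδ.le, by field_simp; ring, Complex.ext ?_ ?_⟩
    · simp only [Complex.add_re, Complex.smul_re, smul_eq_mul, h₁]
      field_simp; ring
    · simp only [Complex.add_im, Complex.smul_im, smul_eq_mul]
      field_simp; ring

theorem mem_segment_gridEdge_false {δ : ℝ} (hδ : 0 < δ) {m n : ℤ} {z : ℂ} :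
    z ∈ segment ℝ (gridEdge δ (m, n, false)).1 (gridEdge δ (m, n, false)).2 ↔
      z.im = δ * n ∧ δ * m ≤ z.re ∧ z.re ≤ δ * (m + 1) := by
  simp only [gridEdge, Bool.false_eq_true, if_false]
  constructor
  · rintro ⟨a, b, ha, hb, hab, rfl⟩
    obtain rfl : a = 1 - b := by linarith
    simp only [Complex.add_re, Complex.smul_re, Complex.add_im, Complex.smul_im, smul_eq_mul]
    exact ⟨by ring, by nlinarith, by nlinarith⟩
  · rintro ⟨h₁, h₂, h₃⟩
    refine ⟨(δ * (m + 1) - z.re) / δ, (z.re - δ * m) / δ, div_nonneg (by linarith) hδ.le,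
      div_nonneg (by linarith) hδ.le, by field_simp; ring, Complex.ext ?_ ?_⟩
    · simp only [Complex.add_re, Complex.smul_re, smul_eq_mul]
      field_simp; ring
    · simp only [Complex.add_im, Complex.smul_im, smul_eq_mul, h₁]
      field_simp; ring

theorem gridEdge_fst_ne_snd {δ : ℝ} (hδ : 0 < δ) (i : ℤ × ℤ × Bool) :
    (gridEdge δ i).1 ≠ (gridEdge δ i).2 := by
  obtain ⟨m, n, _ | _⟩ := i <;> simp [gridEdge, Complex.ext_iff, hδ.ne']

theorem Complex.div_re_nonneg {a b : ℂ} (h : 0 ≤ a.re * b.re + a.im * b.im) : 0 ≤ (a / b).re := by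
  rw [Complex.div_re, ← add_div]
  exact div_nonneg h (Complex.normSq_nonneg b)

theorem mul_sub_sub_nonneg_of_adjacent_intervals {δ x : ℝ} (hδ : 0 < δ) {m m' : ℤ} (hne : m' ≠ m)
    (h₁ : δ * m' ≤ x) (h₂ : x ≤ δ * (m' + 1)) : 0 ≤ (x - δ * m) * (x - δ * (m + 1)) := by
  rcases lt_or_gt_of_ne hne with h | h
  · have h' : (m' : ℝ) + 1 ≤ m := by exact_mod_cast h
    have := mul_le_mul_of_nonneg_left h' hδ.le
    exact mul_nonneg_of_nonpos_of_nonpos (by linarith) (by linarith)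
  · have h' : (m : ℝ) + 1 ≤ m' := by exact_mod_cast h
    have := mul_le_mul_of_nonneg_left h' hδ.le
    exact mul_nonneg (by linarith) (by linarith)

theorem mul_sub_sub_nonneg_of_int {δ : ℝ} (hδ : 0 < δ) (m m' : ℤ) :
    0 ≤ (δ * m' - δ * m) * (δ * m' - δ * (m + 1)) := by
  rcases eq_or_ne m' m with rfl | hne
  · simp
  · exact mul_sub_sub_nonneg_of_adjacent_intervals hδ hne le_rfl (mul_le_mul_of_nonneg_left (by simp) hδ.le)

theorem mul_sub_sub_add_sq_nonneg {δ x : ℝ} {m n n' : ℤ} (hne : n' ≠ n) :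
    0 ≤ (x - δ * m) * (x - δ * (m + 1)) + (δ * n' - δ * n) * (δ * n' - δ * n) := by
  have h : (1 : ℝ) ≤ ((n' : ℝ) - n) ^ 2 := by
    have := Int.one_le_abs (sub_ne_zero.2 hne)
    have h' : (1 : ℝ) ≤ |(n' : ℝ) - n| := by exact_mod_cast this
    rw [← sq_abs]
    nlinarith
  nlinarith [sq_nonneg (x - δ * m - δ / 2), mul_le_mul_of_nonneg_left h (sq_nonneg δ)]

/-- The grid edges do not meet the open discs having the other grid edges as diameters. -/
theorem div_re_nonneg_of_mem_segment_gridEdge {δ : ℝ} (hδ : 0 < δ) {i j : ℤ × ℤ × Bool}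
    (hij : i ≠ j) {z : ℂ} (hz : z ∈ segment ℝ (gridEdge δ j).1 (gridEdge δ j).2) :
    0 ≤ ((z - (gridEdge δ i).1) / (z - (gridEdge δ i).2)).re := by
  apply Complex.div_re_nonneg
  obtain ⟨m, n, _ | _⟩ := i <;> obtain ⟨m', n', _ | _⟩ := j
  · obtain ⟨h₁, h₂, h₃⟩ := (mem_segment_gridEdge_false hδ).1 hz
    simp only [gridEdge, Complex.sub_re, Complex.sub_im, h₁, Bool.false_eq_true, if_false]
    rcases eq_or_ne n' n with rfl | hne
    · have := mul_sub_sub_nonneg_of_adjacent_intervals hδ (m := m) (m' := m') (by rintro rfl; exact hij rfl) h₂ h₃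
      simpa using this
    · exact mul_sub_sub_add_sq_nonneg hne
  · obtain ⟨h₁, -, -⟩ := (mem_segment_gridEdge_true hδ).1 hz
    simp only [gridEdge, Complex.sub_re, Complex.sub_im, h₁, Bool.false_eq_true, if_false]
    exact add_nonneg (mul_sub_sub_nonneg_of_int hδ m m') (mul_self_nonneg _)
  · obtain ⟨h₁, -, -⟩ := (mem_segment_gridEdge_false hδ).1 hz
    simp only [gridEdge, Complex.sub_re, Complex.sub_im, h₁, if_true]
    exact add_nonneg (mul_self_nonneg _) (mul_sub_sub_nonneg_of_int hδ n n')
  · obtain ⟨h₁, h₂, h₃⟩ := (mem_segment_gridEdge_true hδ).1 hz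
    simp only [gridEdge, Complex.sub_re, Complex.sub_im, h₁, if_true]
    rcases eq_or_ne m' m with rfl | hne
    · have := mul_sub_sub_nonneg_of_adjacent_intervals hδ (m := n) (m' := n') (by rintro rfl; exact hij rfl) h₂ h₃
      simpa using this
    · rw [add_comm]
      exact mul_sub_sub_add_sq_nonneg hne

/-- A connected set that avoids the four edges of a grid square and is not contained in the square
avoids the square. -/
theorem IsPreconnected.notMem_of_disjoint_gridEdge {δ : ℝ} (hδ : 0 < δ) {R : Set ℂ}
    (hR : IsPreconnected R) {m n : ℤ}
    (hE : ∀ i ∈ [(m, n, true), (m, n, false), (m + 1, n, true), (m, n + 1, false)],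
      ∀ z ∈ R, z ∉ segment ℝ (gridEdge δ i).1 (gridEdge δ i).2)
    (hout : ∃ w ∈ R, w ∉ Icc (δ * m) (δ * (m + 1)) ×ℂ Icc (δ * n) (δ * (n + 1))) {z : ℂ}
    (hz : z ∈ Icc (δ * m) (δ * (m + 1)) ×ℂ Icc (δ * n) (δ * (n + 1))) : z ∉ R := by
  intro hzR
  simp only [List.forall_mem_cons, mem_segment_gridEdge_true hδ, mem_segment_gridEdge_false hδ,
    List.not_mem_nil, false_imp_iff, implies_true, and_true] at hE
  push_cast at hE
  obtain ⟨h₁, h₂, h₃, h₄⟩ := hE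
  have key : ∀ w ∈ R, w ∈ Icc (δ * m) (δ * (m + 1)) ×ℂ Icc (δ * n) (δ * (n + 1)) →
      w ∈ Ioo (δ * m) (δ * (m + 1)) ×ℂ Ioo (δ * n) (δ * (n + 1)) := by
    rintro w hw ⟨⟨ha, hb⟩, ⟨hc, hd⟩⟩
    refine ⟨⟨lt_of_le_of_ne ha fun h ↦ ?_, lt_of_le_of_ne hb fun h ↦ ?_⟩,
      ⟨lt_of_le_of_ne hc fun h ↦ ?_, lt_of_le_of_ne hd fun h ↦ ?_⟩⟩
    · exact h₁ w hw ⟨h.symm, hc, hd⟩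
    · exact h₃ w hw ⟨h, hc, hd⟩
    · exact h₂ w hw ⟨h.symm, ha, hb⟩
    · exact h₄ w hw ⟨h, ha, hb⟩
  obtain ⟨w, hwR, hw⟩ := hout
  obtain ⟨v, -, hv₁, hv₂⟩ := hR _ _ (isOpen_Ioo.reProdIm isOpen_Ioo)
    (isClosed_Icc.reProdIm isClosed_Icc).isOpen_compl
    (fun v hv ↦ or_iff_not_imp_right.2 fun h ↦ key v hv (not_not.1 h))
    ⟨z, hzR, key z hzR hz⟩ ⟨w, hwR, hw⟩
  exact hv₂ ⟨Ioo_subset_Icc_self hv₁.1, Ioo_subset_Icc_self hv₁.2⟩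

/-- Near a compact set `K` there are finitely many points such that any plane map omitting them
can be changed so as to omit `K`, rel a compact connected set that maps to the closed set `A`. -/
theorem exists_finite_forall_exists_continuous_eqOn_disjoint {X : Type*} [TopologicalSpace X]
    [SimplyConnectedSpace X] [LocallyPathConnectedSpace X] {B : Set X} (hBc : IsCompact B)
    (hB : IsConnected B) {K A : Set ℂ} (hK : IsCompact K) (hA : IsClosed A) (hKA : Disjoint K A) :
    ∃ P : Set ℂ, P.Finite ∧ Disjoint P A ∧ ∀ F : X → ℂ, Continuous F → MapsTo F B A →
      Disjoint (range F) P → ∃ G : X → ℂ, Continuous G ∧ EqOn G F B ∧ Disjoint (range G) K := by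
  classical
  obtain ⟨ε, hε, hεA⟩ := hK.exists_thickening_subset_open hA.isOpen_compl
    (subset_compl_iff_disjoint_right.2 hKA)
  set δ : ℝ := ε / 3 with hδε
  have hδ : 0 < δ := by positivity
  obtain ⟨r, hr⟩ := hK.isBounded.subset_closedBall 0
  obtain ⟨N, hN⟩ := exists_nat_ge (r / δ)
  have hN' : r ≤ δ * N := by rwa [div_le_iff₀' hδ] at hN
  set J : Finset ℤ := Finset.Icc (-(N + 1)) (N + 1) with hJ
  set I : Finset (ℤ × ℤ × Bool) := (J ×ˢ J ×ˢ Finset.univ).filter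
    (fun i ↦ Disjoint (segment ℝ (gridEdge δ i).1 (gridEdge δ i).2) A) with hI
  have hIA : ∀ i ∈ I, Disjoint (segment ℝ (gridEdge δ i).1 (gridEdge δ i).2) A := fun i hi ↦
    (Finset.mem_filter.1 hi).2
  refine ⟨⋃ i ∈ I, {(gridEdge δ i).1, (gridEdge δ i).2}, ?_, ?_, fun F hF hFB hFP ↦ ?_⟩
  · exact I.finite_toSet.biUnion fun i _ ↦ by simp
  · rw [disjoint_iUnion₂_left]
    refine fun i hi ↦ (hIA i hi).mono_left ?_
    rintro z (rfl | rfl)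
    exacts [left_mem_segment ℝ _ _, right_mem_segment ℝ _ _]
  obtain ⟨G, hG, hGF, hGI⟩ := exists_continuous_eqOn_notMem_segments hBc hB (I.image (gridEdge δ))
    (by
      simp only [Finset.forall_mem_image]
      exact fun i _ ↦ gridEdge_fst_ne_snd hδ i)
    (by
      simp only [Finset.forall_mem_image]
      exact fun i _ j _ hij z hz ↦
        div_re_nonneg_of_mem_segment_gridEdge hδ (fun h ↦ hij (congrArg _ h)) hz)
    hF (by
      simp only [Finset.forall_mem_image]
      intro i hi x
      have : F x ∉ ({(gridEdge δ i).1, (gridEdge δ i).2} : Set ℂ) := fun h ↦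
        disjoint_left.1 hFP (mem_range_self x) (mem_iUnion₂.2 ⟨i, hi, h⟩)
      simpa using this)
    (by
      simp only [Finset.forall_mem_image]
      exact fun x hx i hi h ↦ disjoint_left.1 (hIA i hi) h (hFB hx))
  simp only [Finset.forall_mem_image] at hGI
  refine ⟨G, hG, hGF, disjoint_right.2 fun k hk ↦ ?_⟩
  set m := ⌊k.re / δ⌋ with hm
  set n := ⌊k.im / δ⌋ with hn
  have hm₁ : δ * m ≤ k.re := by rw [← le_div_iff₀' hδ]; exact Int.floor_le _
  have hm₂ : k.re ≤ δ * (m + 1) := by rw [← div_le_iff₀' hδ]; exact (Int.lt_floor_add_one _).le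
  have hn₁ : δ * n ≤ k.im := by rw [← le_div_iff₀' hδ]; exact Int.floor_le _
  have hn₂ : k.im ≤ δ * (n + 1) := by rw [← div_le_iff₀' hδ]; exact (Int.lt_floor_add_one _).le
  have hQA : ∀ z ∈ Icc (δ * m) (δ * (m + 1)) ×ℂ Icc (δ * n) (δ * (n + 1)), z ∉ A := by
    rintro z ⟨⟨ha, hb⟩, ⟨hc, hd⟩⟩
    refine hεA (mem_thickening_iff.2 ⟨k, hk, ?_⟩)
    rw [Complex.dist_eq]
    refine (Complex.norm_le_abs_re_add_abs_im _).trans_lt ?_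
    have h₁ : |(z - k).re| ≤ δ := by rw [Complex.sub_re, abs_le]; constructor <;> linarith
    have h₂ : |(z - k).im| ≤ δ := by rw [Complex.sub_im, abs_le]; constructor <;> linarith
    linarith
  have hkr : ‖k‖ ≤ r := by simpa using hr hk
  have hJmem : ∀ x : ℝ, |x| ≤ r → ⌊x / δ⌋ ∈ J ∧ ⌊x / δ⌋ + 1 ∈ J := fun x hx ↦ by
    have hx' := abs_le.1 (hx.trans hN')
    have h₁ : (-N : ℤ) ≤ ⌊x / δ⌋ := by
      rw [Int.le_floor, le_div_iff₀' hδ]; push_cast; linarith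
    have h₂ : ⌊x / δ⌋ ≤ N := by
      have : x / δ ≤ N := by rw [div_le_iff₀' hδ]; linarith
      exact_mod_cast (Int.floor_le _).trans this
    simp only [hJ, Finset.mem_Icc]
    omega
  obtain ⟨hmJ, hmJ'⟩ : m ∈ J ∧ m + 1 ∈ J := hJmem k.re ((Complex.abs_re_le_norm k).trans hkr)
  obtain ⟨hnJ, hnJ'⟩ : n ∈ J ∧ n + 1 ∈ J := hJmem k.im ((Complex.abs_im_le_norm k).trans hkr)
  obtain ⟨b, hb⟩ := hB.nonempty
  refine (isPreconnected_range hG).notMem_of_disjoint_gridEdge hδ (m := m) (n := n) ?_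
    ⟨G b, mem_range_self b, fun h ↦ hQA _ h (by rw [hGF hb]; exact hFB hb)⟩ ⟨⟨hm₁, hm₂⟩, ⟨hn₁, hn₂⟩⟩
  rintro i hi _ ⟨x, rfl⟩
  refine hGI (Finset.mem_filter.2 ⟨?_, disjoint_left.2 fun z hz ↦ hQA z ?_⟩) x
  · simp only [List.mem_cons, List.not_mem_nil, or_false] at hi
    simp only [Finset.mem_product, Finset.mem_univ, and_true]
    rcases hi with rfl | rfl | rfl | rfl <;> constructor <;> assumption
  · simp only [List.mem_cons, List.not_mem_nil, or_false] at hi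
    rcases hi with rfl | rfl | rfl | rfl
    all_goals
      simp only [mem_segment_gridEdge_true hδ, mem_segment_gridEdge_false hδ] at hz
      push_cast at hz
      refine ⟨⟨?_, ?_⟩, ⟨?_, ?_⟩⟩ <;> linarith [hz.1, hz.2.1, hz.2.2]

section SpherePush

variable {E : Type*} [NormedAddCommGroup E] [InnerProductSpace ℝ E]

/-- The punctured ball of radius `r` around `x` can be pushed onto its boundary, inside the
sphere. -/
theorem exists_continuousOn_sphere_push (x : sphere (0 : E) 1) {r : ℝ} (hr : 0 < r)
    (hr2 : r < 2) :
    ∃ T : sphere (0 : E) 1 → sphere (0 : E) 1, ContinuousOn T {x}ᶜ ∧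
      (∀ w, r ≤ dist w x → T w = w) ∧ (∀ w, w ≠ x → dist w x ≤ r → dist (T w) x = r) := by
  classical
  have hn : ∀ w : sphere (0 : E) 1, inner ℝ (w : E) (w : E) = 1 := fun w => by
    rw [real_inner_self_eq_norm_sq, norm_eq_of_mem_sphere w, one_pow]
  have hdist : ∀ w : sphere (0 : E) 1, dist w x ^ 2 = 2 - 2 * inner ℝ (w : E) (x : E) := fun w => by
    rw [Subtype.dist_eq, dist_eq_norm, norm_sub_sq_real, norm_eq_of_mem_sphere w,
      norm_eq_of_mem_sphere x]
    ring
  have hlt : ∀ w : sphere (0 : E) 1, w ≠ x → inner ℝ (w : E) (x : E) < 1 := fun w hw => by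
    have := hdist w
    have := pow_pos (dist_pos.2 hw) 2
    linarith
  set c : ℝ := 1 - r ^ 2 / 2 with hc
  have hc1 : c < 1 := by rw [hc]; nlinarith
  have hc2 : -1 < c := by rw [hc]; nlinarith
  have hs : 0 < 1 - c ^ 2 := by nlinarith
  let a : sphere (0 : E) 1 → ℝ := fun w => inner ℝ (w : E) (x : E)
  have ha : Continuous a := by fun_prop
  let f : sphere (0 : E) 1 → E := fun w => min (a w) c • (x : E) +
    (√(1 - c ^ 2) / √(1 - (max (a w) c) ^ 2)) • ((w : E) - a w • (x : E))
  have hden : ∀ w, w ≠ x → 0 < 1 - (max (a w) c) ^ 2 := fun w hw => by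
    have h1 : max (a w) c < 1 := max_lt (hlt w hw) hc1
    have h2 : -1 < max (a w) c := lt_max_of_lt_right hc2
    nlinarith
  have hfc : ContinuousOn f {x}ᶜ := by
    refine ContinuousOn.add (by fun_prop) (ContinuousOn.smul ?_ (by fun_prop))
    refine ContinuousOn.div continuousOn_const (by fun_prop) fun w hw => ?_
    exact (Real.sqrt_pos.2 (hden w hw)).ne'
  have hfix : ∀ w, a w ≤ c → f w = w := fun w hw => by
    simp only [f, min_eq_left hw, max_eq_right hw]
    rw [div_self (Real.sqrt_pos.2 hs).ne', one_smul]
    abel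
  have hinner : ∀ w, inner ℝ (f w) (x : E) = min (a w) c := fun w => by
    simp only [f, inner_add_left, inner_sub_left, real_inner_smul_left, hn x]
    simp only [a]
    ring
  have hnorm : ∀ w, w ≠ x → f w ∈ sphere (0 : E) 1 := fun w hw => by
    rcases le_total (a w) c with h | h
    · rw [hfix w h]; exact w.2
    · have h1 : 0 < 1 - a w ^ 2 := by simpa [max_eq_left h] using hden w hw
      have h2 : (√(1 - c ^ 2) / √(1 - a w ^ 2)) ^ 2 * (1 - a w ^ 2) = 1 - c ^ 2 := by
        rw [div_pow, Real.sq_sqrt hs.le, Real.sq_sqrt h1.le]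
        field_simp
      rw [mem_sphere_zero_iff_norm, ← sq_eq_sq₀ (norm_nonneg _) zero_le_one,
        ← real_inner_self_eq_norm_sq]
      simp only [f, min_eq_right h, max_eq_left h]
      generalize √(1 - c ^ 2) / √(1 - a w ^ 2) = k at h2
      have h3 : inner ℝ (x : E) (w : E) = a w := real_inner_comm _ _
      have h4 : inner ℝ (w : E) (x : E) = a w := rfl
      simp only [inner_add_left, inner_add_right, inner_sub_left, inner_sub_right,
        real_inner_smul_left, real_inner_smul_right, hn, h3, h4]
      linear_combination h2
  let T : sphere (0 : E) 1 → sphere (0 : E) 1 := fun w =>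
    if h : w = x then w else ⟨f w, hnorm w h⟩
  have hT : ∀ w, w ≠ x → (T w : E) = f w := fun w hw => by simp [T, hw]
  refine ⟨T, ?_, fun w hw => ?_, fun w hw hwr => ?_⟩
  · rw [Topology.IsInducing.subtypeVal.continuousOn_iff]
    exact hfc.congr fun w hw => hT w hw
  · have hne : w ≠ x := dist_pos.1 (hr.trans_le hw)
    refine Subtype.ext ((hT w hne).trans (hfix w ?_))
    have := hdist w
    have : r ^ 2 ≤ dist w x ^ 2 := by gcongr
    simp only [a, hc]
    linarith
  · have h1 : dist w x ^ 2 ≤ r ^ 2 := by gcongr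
    have h2 : c ≤ a w := by
      have := hdist w
      simp only [a, hc]
      linarith
    rw [← sq_eq_sq₀ dist_nonneg hr.le, hdist, hT w hw, hinner, min_eq_right h2, hc]
    ring

variable {X : Type*} [TopologicalSpace X] {B : Set X}

theorem exists_continuous_eqOn_disjoint_of_dist_lt {F : X → sphere (0 : E) 1} (hF : Continuous F)
    {x z : sphere (0 : E) 1} {ρ : ℝ} (hρ : ρ < 2) (hxz : dist z x < ρ)
    (hB : ∀ b ∈ B, ρ ≤ dist (F b) x) {P : Set (sphere (0 : E) 1)} (hP : P.Finite)
    (hFP : Disjoint (range F) (insert x P)) :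
    ∃ G : X → sphere (0 : E) 1, Continuous G ∧ EqOn G F B ∧
      Disjoint (range G) (insert x (insert z P)) := by
  have hinf : (Ioo (dist z x) ρ).Infinite := Ioo_infinite hxz
  obtain ⟨r, ⟨hr1, hr2⟩, hrP⟩ :=
    (hinf.sdiff (hP.image fun p => dist p x)).nonempty
  have hr0 : 0 < r := dist_nonneg.trans_lt hr1
  obtain ⟨T, hTc, hT1, hT2⟩ := exists_continuousOn_sphere_push x hr0 (hr2.trans hρ)
  have hFx : ∀ u, F u ≠ x := fun u hu =>
    disjoint_left.1 hFP ⟨u, rfl⟩ (hu ▸ mem_insert _ _)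
  have hge : ∀ u, r ≤ dist (T (F u)) x := fun u => by
    rcases le_total (dist (F u) x) r with h | h
    · exact (hT2 _ (hFx u) h).ge
    · rwa [hT1 _ h]
  refine ⟨T ∘ F, hTc.comp_continuous hF hFx, fun b hb => hT1 _ (hr2.le.trans (hB b hb)), ?_⟩
  rw [disjoint_left]
  rintro _ ⟨u, rfl⟩ (h | h | h)
  · have := hge u
    rw [show T (F u) = x from h, dist_self] at this
    linarith
  · have := hge u
    rw [show T (F u) = z from h] at this
    linarith
  · rcases le_total (dist (F u) x) r with h' | h'
    · exact hrP ⟨_, h, hT2 _ (hFx u) h'⟩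
    · refine disjoint_left.1 hFP ⟨u, rfl⟩ (mem_insert_of_mem _ ?_)
      simpa [hT1 _ h'] using h

/-- In a connected open set `U`, the points omitted by an extension of `f` can be increased one at
a time, at the cost of changing the extension. -/
theorem exists_continuous_eqOn_disjoint_insert {U : Set (sphere (0 : E) 1)} (hU : IsOpen U)
    (hUc : IsPreconnected U) {f : X → sphere (0 : E) 1} (hf : MapsTo f B Uᶜ)
    {x z : sphere (0 : E) 1} (hx : x ∈ U) (hz : z ∈ U) :
    ∀ F : X → sphere (0 : E) 1, Continuous F → EqOn F f B → ∀ P : Set (sphere (0 : E) 1),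
      P.Finite → Disjoint (range F) (insert x P) →
      ∃ G : X → sphere (0 : E) 1, Continuous G ∧ EqOn G f B ∧
        Disjoint (range G) (insert x (insert z P)) := by
  have step : ∀ (x z : sphere (0 : E) 1) (ρ : ℝ), ρ < 2 → ball x ρ ⊆ U → dist z x < ρ →
      ∀ F : X → sphere (0 : E) 1, Continuous F → EqOn F f B → ∀ P : Set (sphere (0 : E) 1),
      P.Finite → Disjoint (range F) (insert x P) →
      ∃ G : X → sphere (0 : E) 1, Continuous G ∧ EqOn G f B ∧
        Disjoint (range G) (insert x (insert z P)) := by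
    intro x z ρ hρ hball hzx F hF hFf P hP hFP
    obtain ⟨G, hG, hGF, hGP⟩ := exists_continuous_eqOn_disjoint_of_dist_lt (B := B) hF hρ hzx
      (fun b hb => by
        by_contra! h
        exact hf hb (hFf hb ▸ hball h)) hP hFP
    exact ⟨G, hG, hGF.trans hFf, hGP⟩
  refine hUc.induction₂' (fun x z => ∀ F : X → sphere (0 : E) 1, Continuous F → EqOn F f B →
      ∀ P : Set (sphere (0 : E) 1), P.Finite → Disjoint (range F) (insert x P) →
      ∃ G : X → sphere (0 : E) 1, Continuous G ∧ EqOn G f B ∧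
        Disjoint (range G) (insert x (insert z P))) ?_ ?_ hx hz
  · intro x hx
    obtain ⟨ε, hε, hball⟩ := Metric.isOpen_iff.1 hU x hx
    have hρ : 0 < min ε 1 := lt_min hε one_pos
    have hball' : ball x (min ε 1) ⊆ U := (ball_subset_ball (min_le_left _ _)).trans hball
    have hle : min ε 1 ≤ 1 := min_le_right _ _
    filter_upwards [mem_nhdsWithin_of_mem_nhds (ball_mem_nhds x (half_pos hρ))] with z hz
    have hz' : dist z x < min ε 1 / 2 := hz
    refine ⟨step x z _ (by linarith) hball' (by linarith),
      step z x (min ε 1 / 2) (by linarith) ((ball_subset_ball' ?_).trans hball')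
        (by rwa [dist_comm])⟩
    linarith
  · intro x y z _ _ _ hxy hyz F hF hFf P hP hFP
    obtain ⟨G, hG, hGf, hGP⟩ := hxy F hF hFf P hP hFP
    obtain ⟨G', hG', hGf', hGP'⟩ := hyz G hG hGf (insert x P) (hP.insert x)
      (by rwa [insert_comm])
    refine ⟨G', hG', hGf', hGP'.mono_right ?_⟩
    intro w
    simp only [mem_insert_iff]
    tauto

theorem exists_continuous_eqOn_disjoint_finite {U : Set (sphere (0 : E) 1)} (hU : IsOpen U)
    (hUc : IsPreconnected U) {F : X → sphere (0 : E) 1} (hF : Continuous F)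
    (hFU : MapsTo F B Uᶜ) {x : sphere (0 : E) 1} (hx : x ∈ U) (hFx : x ∉ range F)
    {P : Set (sphere (0 : E) 1)} (hP : P.Finite) (hPU : P ⊆ U) :
    ∃ G : X → sphere (0 : E) 1, Continuous G ∧ EqOn G F B ∧
      Disjoint (range G) (insert x P) := by
  induction P, hP using Set.Finite.induction_on with
  | empty => exact ⟨F, hF, fun _ _ => rfl, by simpa using hFx⟩
  | @insert p P _ hP ih =>
    obtain ⟨G, hG, hGF, hGP⟩ := ih ((subset_insert _ _).trans hPU)
    exact exists_continuous_eqOn_disjoint_insert hU hUc hFU hx (hPU (mem_insert _ _)) G hG hGF P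
      hP hGP

end SpherePush

/-- Stereographic projection from `v`, with values in `ℂ`. -/
theorem exists_continuous_complex_chart_sphere (v : sphere (0 : EuclideanSpace ℝ (Fin 3)) 1) :
    ∃ (φ : sphere (0 : EuclideanSpace ℝ (Fin 3)) 1 → ℂ)
      (ψ : ℂ → sphere (0 : EuclideanSpace ℝ (Fin 3)) 1),
      ContinuousOn φ {v}ᶜ ∧ Continuous ψ ∧ (∀ z, ψ z ≠ v) ∧ (∀ z, φ (ψ z) = z) ∧
        ∀ w, w ≠ v → ψ (φ w) = w := by
  have : Fact (Module.finrank ℝ (EuclideanSpace ℝ (Fin 3)) = 2 + 1) :=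
    ⟨finrank_euclideanSpace_fin⟩
  let e := (stereographic' 2 v).trans
    Complex.orthonormalBasisOneI.repr.symm.toHomeomorph.toOpenPartialHomeomorph
  have hsrc : e.source = {v}ᶜ := by simp [e]
  have htgt : e.target = univ := by simp [e]
  refine ⟨e, e.symm, hsrc ▸ e.continuousOn, ?_, fun z => ?_, fun z => ?_, fun w hw => ?_⟩
  · rw [← continuousOn_univ, ← htgt]
    exact e.continuousOn_symm
  · have : e.symm z ∈ e.source := e.map_target (htgt ▸ mem_univ z)
    rwa [hsrc] at this
  · exact e.right_inv (htgt ▸ mem_univ z)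
  · exact e.left_inv (hsrc ▸ hw)

/-- A map from a connected compact subset of a simply connected space to the 2-sphere that omits a
connected open set `U` extends to the whole space with values close to the complement of `U`. -/
theorem exists_continuous_extension_range_subset {X : Type*} [TopologicalSpace X] [T2Space X]
    [NormalSpace X] [SimplyConnectedSpace X] [LocallyPathConnectedSpace X] {B : Set X}
    (hBc : IsCompact B) (hB : IsConnected B)
    {g : B → sphere (0 : EuclideanSpace ℝ (Fin 3)) 1} (hg : Continuous g)
    {U N : Set (sphere (0 : EuclideanSpace ℝ (Fin 3)) 1)} (hU : IsOpen U)
    (hUc : IsPreconnected U) (hUne : U.Nonempty) (hgU : ∀ b, g b ∉ U) (hN : IsOpen N)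
    (hUN : Uᶜ ⊆ N) :
    ∃ G : X → sphere (0 : EuclideanSpace ℝ (Fin 3)) 1,
      Continuous G ∧ (∀ b : B, G b = g b) ∧ range G ⊆ N := by
  obtain ⟨v, hv⟩ := hUne
  obtain ⟨φ, ψ, hφ, hψ, hψv, hφψ, hψφ⟩ := exists_continuous_complex_chart_sphere v
  have hne : ∀ w ∉ U, w ≠ v := fun w hw h => hw (h ▸ hv)
  have hA : IsCompact (ψ ⁻¹' Uᶜ) := by
    have : ψ ⁻¹' Uᶜ = φ '' Uᶜ := by
      ext z
      refine ⟨fun hz => ⟨ψ z, hz, hφψ z⟩, ?_⟩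
      rintro ⟨w, hw, rfl⟩
      simpa [hψφ w (hne w hw)] using hw
    rw [this]
    exact hU.isClosed_compl.isCompact.image_of_continuousOn (hφ.mono hne)
  obtain ⟨M, hM⟩ := hA.isBounded.subset_ball 0
  set V : Set ℂ := ψ ⁻¹' N ∩ ball 0 M with hV
  have hVo : IsOpen V := (hN.preimage hψ).inter isOpen_ball
  have hAV : ψ ⁻¹' Uᶜ ⊆ V := subset_inter (preimage_mono hUN) hM
  have hK : IsCompact (frontier V) :=
    Metric.isCompact_of_isClosed_isBounded isClosed_frontier
      ((isBounded_ball.subset inter_subset_right).closure.subset frontier_subset_closure)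
  have hKA : Disjoint (frontier V) (ψ ⁻¹' Uᶜ) :=
    (disjoint_frontier_iff_isOpen.2 hVo).mono_right hAV
  obtain ⟨P, hP, hPA, hPG⟩ :=
    exists_finite_forall_exists_continuous_eqOn_disjoint (X := X) hBc hB hK hA.isClosed hKA
  obtain ⟨f, hf⟩ := ContinuousMap.exists_restrict_eq hBc.isClosed
    (⟨φ ∘ g, hφ.comp_continuous hg fun b => hne _ (hgU b)⟩ : C(B, ℂ))
  have hfb : ∀ b : B, ψ (f b) = g b := fun b => by
    rw [show f b = φ (g b) from DFunLike.congr_fun hf b, hψφ _ (hne _ (hgU b))]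
  obtain ⟨F, hF, hFf, hFP⟩ := exists_continuous_eqOn_disjoint_finite (B := B) (F := ψ ∘ f)
    (P := ψ '' P) hU hUc (hψ.comp f.continuous)
    (fun b hb => by
      have := hgU ⟨b, hb⟩
      rwa [← hfb ⟨b, hb⟩] at this)
    hv (by rintro ⟨u, hu⟩; exact hψv _ hu) (hP.image _)
    (by
      rintro _ ⟨p, hp, rfl⟩
      by_contra h
      exact disjoint_left.1 hPA hp h)
  have hFv : ∀ u, F u ≠ v := fun u hu =>
    disjoint_left.1 hFP ⟨u, rfl⟩ (hu ▸ mem_insert _ _)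
  have hFB : ∀ b : B, F b = g b := fun b => (hFf b.2).trans (hfb b)
  obtain ⟨G, hG, hGF, hGK⟩ := hPG (φ ∘ F) (hφ.comp_continuous hF hFv)
    (fun b hb => by
      change ψ (φ (F b)) ∉ U
      rw [hψφ _ (hFv b), hFB ⟨b, hb⟩]
      exact hgU _)
    (by
      rw [disjoint_left]
      rintro _ ⟨u, rfl⟩ hu
      exact disjoint_left.1 hFP ⟨u, rfl⟩ (mem_insert_of_mem _ ⟨_, hu, hψφ _ (hFv u)⟩))
  have hGB : ∀ b : B, ψ (G b) = g b := fun b => by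
    rw [hGF b.2, Function.comp_apply, hψφ _ (hFv b), hFB b]
  have hGV : range G ⊆ V := by
    refine (isPreconnected_range hG).subset_left_of_subset_union hVo
      isClosed_closure.isOpen_compl (disjoint_compl_right.mono_left subset_closure) ?_ ?_
    · intro z hz
      by_contra h
      rw [mem_union, not_or, notMem_compl_iff] at h
      exact disjoint_left.1 hGK hz ⟨h.2, fun hi => h.1 (interior_subset hi)⟩
    · obtain ⟨b, hb⟩ := hB.nonempty
      refine ⟨G b, ⟨b, rfl⟩, hAV ?_⟩
      change ψ (G b) ∉ U
      rw [hGB ⟨b, hb⟩]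
      exact hgU _
  refine ⟨ψ ∘ G, hψ.comp hG, hGB, ?_⟩
  rintro _ ⟨u, rfl⟩
  exact (hGV ⟨u, rfl⟩).1

end SphereLoop


/-- Lemma 2.16 (sphere_contract): if `γ` is a non-space-filling loop in a
geodesic metric sphere, `U` a connected component of the complement of its
range and `A = S \ U`, then for every `ε > 0` the loop `γ` is null-homotopic
inside the `ε`-thickening of `A`. -/
theorem loop_nullhomotopic_in_thickening_of_complement
    {S : Type*} [MetricSpace S]
    (hgeo : IsGeodesicSpace S)
    (hsph : Nonempty (S ≃ₜ Metric.sphere (0 : EuclideanSpace ℝ (Fin 3)) 1))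
    (γ : Metric.sphere (0 : EuclideanSpace ℝ (Fin 2)) 1 → S)
    (hγ : Continuous γ)
    (hrange : Set.range γ ≠ Set.univ)
    (U : Set S) (y : S)
    (hy : y ∈ (Set.range γ)ᶜ)
    (hU : U = connectedComponentIn ((Set.range γ)ᶜ) y)
    (A : Set S) (hA : A = Uᶜ) :
    ∀ ε : ℝ, 0 < ε →
      ∃ (H : Set.Icc (0 : ℝ) 1 × Metric.sphere (0 : EuclideanSpace ℝ (Fin 2)) 1 → S)
        (c : S),
        Continuous H ∧
        (∀ z, H (⟨0, Set.mem_Icc.mpr ⟨le_rfl, zero_le_one⟩⟩, z) = γ z) ∧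
        (∀ z, H (⟨1, Set.mem_Icc.mpr ⟨zero_le_one, le_rfl⟩⟩, z) = c) ∧
        (∀ p, H p ∈ Metric.thickening ε A) := by
  intro ε hε
  obtain ⟨h⟩ := hsph
  have : Fact (Module.finrank ℝ (EuclideanSpace ℝ (Fin 3)) = 2 + 1) :=
    ⟨finrank_euclideanSpace_fin⟩
  have : LocallyConnectedSpace (Metric.sphere (0 : EuclideanSpace ℝ (Fin 3)) 1) :=
    ChartedSpace.locallyConnectedSpace (EuclideanSpace ℝ (Fin 2)) _
  have : LocallyConnectedSpace S := h.isOpenEmbedding.locallyConnectedSpace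
  have hUo : IsOpen U := hU ▸ (isCompact_range hγ).isClosed.isOpen_compl.connectedComponentIn
  have hUc : IsPreconnected U := hU ▸ isPreconnected_connectedComponentIn
  have hγU : ∀ b, γ b ∉ U := fun b hb => by
    rw [hU] at hb
    exact connectedComponentIn_subset _ _ hb ⟨b, rfl⟩
  have hyU : y ∈ U := hU ▸ mem_connectedComponentIn hy
  have hBconn : IsConnected (Metric.sphere (0 : EuclideanSpace ℝ (Fin 2)) 1) := by
    refine isConnected_sphere ?_ 0 zero_le_one
    rw [← Module.finrank_eq_rank, finrank_euclideanSpace_fin]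
    norm_num
  obtain ⟨G, hG, hGγ, hGN⟩ := exists_continuous_extension_range_subset
    (isCompact_sphere (0 : EuclideanSpace ℝ (Fin 2)) 1) hBconn (h.continuous.comp hγ)
    (U := h.symm ⁻¹' U) (N := h.symm ⁻¹' Metric.thickening ε A) (hUo.preimage h.symm.continuous)
    (h.image_eq_preimage_symm U ▸ hUc.image h h.continuous.continuousOn)
    ⟨h y, by simpa using hyU⟩ (fun b => by simpa using hγU b)
    (Metric.isOpen_thickening.preimage h.symm.continuous)
    (by
      rw [← Set.preimage_compl, ← hA]
      exact Set.preimage_mono (Metric.self_subset_thickening hε A))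
  refine ⟨fun p => h.symm (G ((1 - (p.1 : ℝ)) • (p.2 : EuclideanSpace ℝ (Fin 2)))),
    h.symm (G 0), ?_, fun z => ?_, fun z => ?_, fun p => hGN ⟨_, rfl⟩⟩
  · exact h.symm.continuous.comp (hG.comp (by fun_prop))
  · simp [hGγ]
  · simp
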